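/- Let n and c be integers with n-1 ≥ c ≥ 4. Every 2-connected graph G of order n with circumference c satisfies e(G) ≤ max{f(n,c,2), f(n,c,⌊c/2⌋)}. -/

import Mathlib

open SimpleGraph

/-- The degree of a vertex, as `Nat.card` of its neighbor set. -/
noncomputable def degN {V : Type*} (G : SimpleGraph V) (v : V) : ℕ :=
  Nat.card (G.neighborSet v)

/-- `G` has minimum degree exactly `k`. -/
def MinDegreeEq {V : Type*} (G : SimpleGraph V) (k : ℕ) : Prop :=
  (∀ v, k ≤ degN G v) ∧ ∃ v, degN G v = k

/-- `G` is 2-connected: at least 3 vertices and deleting any vertex leaves a connected graph. -/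
def TwoConnected {V : Type*} (G : SimpleGraph V) : Prop :=
  3 ≤ Nat.card V ∧ ∀ v : V, (G.induce {u | u ≠ v}).Connected

/-- The circumference of `G`: the length of a longest cycle (0 if there are none). -/
noncomputable def circ {V : Type*} (G : SimpleGraph V) : ℕ :=
  sSup {n | ∃ (v : V) (w : G.Walk v v), w.IsCycle ∧ w.length = n}

/-- The detour order of `G`: the number of vertices of a longest path. -/
noncomputable def detour {V : Type*} (G : SimpleGraph V) : ℕ :=
  sSup {n | ∃ (u v : V) (p : G.Walk u v), p.IsPath ∧ p.length + 1 = n}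

/-- The number of cliques of cardinality `s` in `G`. -/
noncomputable def cliquesN {V : Type*} (G : SimpleGraph V) (s : ℕ) : ℕ :=
  Nat.card {S : Finset V // G.IsNClique s S}

/-- The number of edges of `G`. -/
noncomputable def edgeCount {V : Type*} (G : SimpleGraph V) : ℕ :=
  Nat.card G.edgeSet

/-- `G` contains a Hamilton cycle. -/
def IsHamiltonianGr {V : Type*} (G : SimpleGraph V) : Prop :=
  ∃ (v : V) (w : G.Walk v v), w.IsCycle ∧ ∀ u : V, u ∈ w.support

/-- `G` contains a Hamilton path. -/
def IsTraceableGr {V : Type*} (G : SimpleGraph V) : Prop :=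
  ∃ (u v : V) (p : G.Walk u v), p.IsPath ∧ ∀ w : V, w ∈ p.support

/-- `f_s(n,c,k) = C(c+1-k, s) + (n-c-1+k)·C(k, s-1)`. -/
def fCliques (n c k s : ℕ) : ℕ :=
  Nat.choose (c + 1 - k) s + (n + k - c - 1) * Nat.choose k (s - 1)

/-- `g_s(n,c,k) = C(c+1-t, s) + (n-c-2+t)·C(t, s-1) + C(k, s-1)` with `t = ⌊c/2⌋`. -/
def gCliques (n c k s : ℕ) : ℕ :=
  Nat.choose (c + 1 - c / 2) s + (n + c / 2 - c - 2) * Nat.choose (c / 2) (s - 1)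
    + Nat.choose k (s - 1)

/-- `g_s(n,c,k,q) = q·C(k, s-1) + (n-q-c-1+t)·C(t, s-1) + C(c+1-t, s)` with `t = ⌊c/2⌋`. -/
def gCliquesQ (n c k q s : ℕ) : ℕ :=
  q * Nat.choose k (s - 1) + (n + c / 2 - q - c - 1) * Nat.choose (c / 2) (s - 1)
    + Nat.choose (c + 1 - c / 2) s

/-- `F(n,c,k) = K_k ∨ (K_{c+1-2k} + \overline{K_{n-c-1+k}})`, realized on `Fin n`:
vertices `0,…,k-1` are the dominating clique `K_k`, vertices `k,…,c-k` extend it to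
`K_{c+1-k}`, and vertices `c-k+1,…,n-1` form the independent part. -/
def Fgraph (n c k : ℕ) : SimpleGraph (Fin n) where
  Adj x y := x ≠ y ∧ (x.val < k ∨ y.val < k ∨ (x.val ≤ c - k ∧ y.val ≤ c - k))
  symm := by constructor; intro x y h; exact ⟨h.1.symm, by tauto⟩
  loopless := by constructor; intro x h; exact h.1 rfl

/-- `G(n,c,k)`: from `K_t ∨ (K_{c+1-2t} + \overline{K_{n-c-1+t}})` (with `t = ⌊c/2⌋`)
delete `t-k` edges incident to one common vertex (the vertex `n-1`) of the independent
part, keeping only its `k` neighbors `0,…,k-1`. -/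
def Ggraph (n c k : ℕ) : SimpleGraph (Fin n) :=
  (Fgraph n c (c / 2)).deleteEdges
    {e | ∃ x y : Fin n, e = s(x, y) ∧ x.val = n - 1 ∧ k ≤ y.val ∧ y.val < c / 2}


inductive PS {V : Type} [DecidableEq V] (G : SimpleGraph V) : V → V → Finset V → Prop
  | single (u : V) : PS G u u {u}
  | cons {u w v : V} {S : Finset V} (h : G.Adj u w) (p : PS G w v S) (hu : u ∉ S) :
      PS G u v (insert u S)

namespace PS
variable {V : Type} [DecidableEq V] {G : SimpleGraph V}

lemma left_mem {u v : V} {S : Finset V} (h : PS G u v S) : u ∈ S := by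
  cases h <;> simp

lemma right_mem {u v : V} {S : Finset V} (h : PS G u v S) : v ∈ S := by
  induction h with
  | single u => simp
  | cons h p hu ih => simp [ih]

lemma append {u v w z : V} {S T : Finset V} (h : PS G u v S) (e : G.Adj v w) (h' : PS G w z T)
    (d : ∀ x ∈ S, x ∉ T) : PS G u z (S ∪ T) := by
  induction h with
  | single u =>
    have := PS.cons e h' (d u (by simp))
    rwa [← Finset.insert_eq]
  | cons a p hu ih =>
    rw [Finset.insert_union]
    refine PS.cons a (ih e ?_) ?_
    · intro x hx; exact d x (by simp [hx])
    · have := d _ (Finset.mem_insert_self _ _)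
      simp [hu, this]

lemma symm {u v : V} {S : Finset V} (h : PS G u v S) : PS G v u S := by
  induction h with
  | single u => exact PS.single u
  | cons a p hu ih =>
    have := ih.append a.symm (PS.single _) (by intro x hx; simp; rintro rfl; exact hu hx)
    rwa [Finset.union_comm, ← Finset.insert_eq] at this

lemma glue {u v w : V} {S T : Finset V} (h : PS G u v S) (h' : PS G v w T)
    (d : ∀ x ∈ S, x ∈ T → x = v) : PS G u w (S ∪ T) := by
  cases h' with
  | single => 
    have := h.right_mem
    rwa [Finset.union_eq_left.2 (by simpa using this)]
  | cons a p hu =>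
    have h2 := h.append a p (by
      intro x hx hx'
      have := d x hx (by simp [hx'])
      subst this; exact hu hx')
    convert h2 using 1
    have := h.right_mem
    ext x; simp; grind

lemma snoc {u v w : V} {S : Finset V} (h : PS G u v S) (e : G.Adj v w) (hw : w ∉ S) :
    PS G u w (insert w S) := (PS.cons e.symm h.symm hw).symm

lemma split {u v w : V} {S : Finset V} (h : PS G u v S) (hw : w ∈ S) :
    ∃ S₁ S₂, PS G u w S₁ ∧ PS G w v S₂ ∧ S₁ ∪ S₂ = S ∧ ∀ x ∈ S₁, x ∈ S₂ → x = w := by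
  induction h with
  | single u =>
    simp at hw; subst hw
    exact ⟨{w}, {w}, PS.single _, PS.single _, by simp, by simp⟩
  | @cons u w' v S a p hu ih =>
    by_cases hwu : w = u
    · subst hwu
      exact ⟨{w}, _, PS.single _, PS.cons a p hu, by simp, by simp⟩
    · obtain ⟨S₁, S₂, h1, h2, h3, h4⟩ := ih (by simpa [hwu] using hw)
      refine ⟨insert u S₁, S₂, PS.cons a h1 ?_, h2, ?_, ?_⟩
      · grind
      · grind
      · grind

/-- first hit of `B` -/
lemma hit {u v : V} {S B : Finset V} (h : PS G u v S) (hv : v ∈ B) :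
    ∃ z T, PS G u z T ∧ T ⊆ S ∧ z ∈ B ∧ ∀ x ∈ T, x ∈ B → x = z := by
  induction h with
  | single u => exact ⟨u, {u}, PS.single _, by simp, hv, by simp⟩
  | @cons u w' v S a p hu ih =>
    by_cases hB : u ∈ B
    · exact ⟨u, {u}, PS.single _, by simp, hB, by simp⟩
    · obtain ⟨z, T, h1, h2, h3, h4⟩ := ih hv
      exact ⟨z, insert u T, PS.cons a h1 (by grind), by grind, h3, by grind⟩

lemma hit2 {u v : V} {S A B : Finset V} (h : PS G u v S) (hu : u ∈ A) (hv : v ∈ B) :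
    ∃ w z T, PS G w z T ∧ T ⊆ S ∧ w ∈ A ∧ z ∈ B ∧ (∀ x ∈ T, x ∈ A → x = w) ∧
      ∀ x ∈ T, x ∈ B → x = z := by
  obtain ⟨z, T, h1, h2, h3, h4⟩ := h.hit hv
  obtain ⟨w, T', k1, k2, k3, k4⟩ := h1.symm.hit hu
  exact ⟨w, z, T', k1.symm, by grind, k3, h3, k4, by grind⟩

lemma to_walk {u v : V} {S : Finset V} (h : PS G u v S) :
    ∃ p : G.Walk u v, p.IsPath ∧ p.support.toFinset = S := by
  induction h with
  | single u => exact ⟨Walk.nil, by simp, by simp⟩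
  | cons a p hu ih =>
    obtain ⟨q, hq, hs⟩ := ih
    refine ⟨Walk.cons a q, ?_, ?_⟩
    · rw [Walk.cons_isPath_iff]; refine ⟨hq, ?_⟩
      intro h; apply hu; rw [← hs]; simpa using h
    · simp [hs]

lemma of_walk {u v : V} (p : G.Walk u v) (hp : p.IsPath) : PS G u v p.support.toFinset := by
  induction p with
  | nil => simpa using PS.single _
  | cons a q ih =>
    rw [Walk.cons_isPath_iff] at hp
    simpa using PS.cons a (ih hp.1) (by simpa using hp.2)

lemma mono {G' : SimpleGraph V} (hG : G ≤ G') {u v : V} {S : Finset V} (h : PS G u v S) :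
    PS G' u v S := by
  induction h with
  | single u => exact PS.single _
  | cons a p hu ih => exact PS.cons (hG a) ih hu

lemma seg (v : ℕ → V) (m : ℕ) (hinj : ∀ i ≤ m, ∀ j ≤ m, v i = v j → i = j)
    (hadj : ∀ i < m, G.Adj (v i) (v (i+1))) (i : ℕ) (d : ℕ) (hij : i + d ≤ m) :
    PS G (v i) (v (i + d)) ((Finset.Icc i (i+d)).image v) := by
  induction d with
  | zero => simpa using PS.single _
  | succ d ih =>
    have := (ih (by omega)).snoc (hadj (i+d) (by omega)) (by
      simp only [Finset.mem_image, Finset.mem_Icc, not_exists, not_and]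
      intro x hx he
      have := hinj _ (by omega) _ (by omega) he
      omega)
    rw [← Finset.image_insert] at this
    have e : Finset.Icc i (i + (d + 1)) = insert (i + d + 1) (Finset.Icc i (i + d)) := by
      ext x; simp; omega
    rw [e]; exact this

/-- clique Hamilton path -/
lemma clique (T : Finset V) : ∀ u ∈ T, ∀ v ∈ T, u ≠ v →
    (∀ x ∈ T, ∀ y ∈ T, x ≠ y → G.Adj x y) → PS G u v T := by
  induction T using Finset.strongInduction with
  | H T ih =>
    intro u hu v hv huv hT
    by_cases h : ∃ w ∈ T, w ≠ u ∧ w ≠ v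
    · obtain ⟨w, hw, hwu, hwv⟩ := h
      have := ih (T.erase u) (Finset.erase_ssubset hu) w (by grind) v (by grind) hwv
        (by grind)
      have := PS.cons (hT u hu w hw hwu.symm) this (by simp)
      rwa [Finset.insert_erase hu] at this
    · have : T = insert u {v} := by grind
      rw [this]
      exact PS.cons (hT u hu v hv huv) (PS.single _) (by simpa using huv)

lemma add_edge {a b u v : V} {S : Finset V} (h : PS (G ⊔ edge u v) a b S) :
    PS G a b S ∨ ∃ S₁ S₂, S₁ ∪ S₂ = S ∧ (∀ x ∈ S₁, x ∉ S₂) ∧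
      ((PS G a u S₁ ∧ PS G v b S₂) ∨ (PS G a v S₁ ∧ PS G u b S₂)) := by
  induction h with
  | single u => exact Or.inl (PS.single _)
  | @cons a c b S h p ha ih =>
    by_cases hG : G.Adj a c
    · rcases ih with ih | ⟨S₁, S₂, h1, h2, h3⟩
      · exact Or.inl (PS.cons hG ih ha)
      · refine Or.inr ⟨insert a S₁, S₂, by grind, by grind, ?_⟩
        rcases h3 with ⟨h3, h4⟩ | ⟨h3, h4⟩
        · exact Or.inl ⟨PS.cons hG h3 (by grind), h4⟩
        · exact Or.inr ⟨PS.cons hG h3 (by grind), h4⟩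
    · have he : (a = u ∧ c = v) ∨ (a = v ∧ c = u) := by
        have := h
        rw [SimpleGraph.sup_adj, SimpleGraph.edge_adj] at this
        tauto
      have key : PS G c b S := by
        rcases ih with ih | ⟨S₁, S₂, h1, h2, h3⟩
        · exact ih
        · exfalso
          rcases h3 with ⟨h3, h4⟩ | ⟨h3, h4⟩ <;> 
          · have q1 := h3.right_mem
            have q2 := h4.left_mem
            rcases he with ⟨rfl, rfl⟩ | ⟨rfl, rfl⟩ <;> grind
      refine Or.inr ⟨{a}, S, rfl, by simpa using ha, ?_⟩
      rcases he with ⟨rfl, rfl⟩ | ⟨rfl, rfl⟩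
      · exact Or.inl ⟨PS.single _, key⟩
      · exact Or.inr ⟨PS.single _, key⟩

end PS

/-- no vertex separates -/
def TC {V : Type} [DecidableEq V] (G : SimpleGraph V) : Prop :=
  ∀ c a b : V, a ≠ c → b ≠ c → ∃ S, PS G a b S ∧ c ∉ S

/-- no cycle longer than `c` -/
def NoLong {V : Type} [DecidableEq V] (G : SimpleGraph V) (c : ℕ) : Prop :=
  ∀ u v S, PS G u v S → G.Adj u v → S.card ≤ c

/-- two disjoint paths from `A` (one at `va`) to `Z` (one at `vj`) -/
def TwoDisj {V : Type} [DecidableEq V] (G : SimpleGraph V) (A Z : Finset V) (va vj : V) : Prop :=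
  ∃ s e s' e' X Y, PS G s e X ∧ PS G s' e' Y ∧ (∀ x ∈ X, x ∉ Y) ∧ s ∈ A ∧ s' ∈ A ∧
    (∀ x ∈ X, x ∈ A → x = s) ∧ (∀ x ∈ Y, x ∈ A → x = s') ∧ (s = va ∨ s' = va) ∧
    (∀ x ∈ X, x ∈ Z → x = e) ∧ (∀ x ∈ Y, x ∈ Z → x = e') ∧ e = vj ∧ e' ∈ Z

section
variable {V : Type} [DecidableEq V] {G : SimpleGraph V}

lemma TwoDisj.step (hG : TC G) {A Z : Finset V} {va vj vk : V} (hjk : G.Adj vj vk)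
    (h1 : vj ∉ insert vk Z) (h2 : vk ∉ Z) (h3 : vk ∉ A) (h4 : ∀ x ∈ A, x ∉ Z)
    (hZ : Z.Nonempty) (h : TwoDisj G A (insert vj (insert vk Z)) va vj) :
    TwoDisj G A (insert vk Z) va vk := by
  obtain ⟨s, e, s', e', X, Y, hX, hY, hd, hs, hs', hXA, hYA, hva, hXZ, hYZ, rfl, he'⟩ := h
  have m1 := hX.left_mem
  have m2 := hX.right_mem
  have m3 := hY.left_mem
  have m4 := hY.right_mem
  have kX : vk ∉ X := by grind
  have hX' : PS G s vk (insert vk X) := hX.snoc hjk kX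
  by_cases hk : e' = vk
  · subst hk
    obtain ⟨z0, hz0⟩ := hZ
    obtain ⟨S, hS, hkS⟩ := hG e' s z0 (by grind) (by grind)
    obtain ⟨w, z, T, hT, hTS, hwA, hzZ, hTA, hTZ⟩ :=
      hS.hit2 (A := (A ∪ X ∪ Y).erase e') (B := Z) (by grind) hz0
    have n1 := hT.left_mem
    have n2 := hT.right_mem
    by_cases hwX : w ∈ X
    · obtain ⟨S₁, S₂, k1, k2, k3, k4⟩ := hX.split hwX
      refine ⟨s', e', s, z, Y, S₁ ∪ T, hY, k1.glue hT (by grind), ?_, hs', hs, hYA, ?_, hva.symm,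
        ?_, ?_, rfl, by grind⟩ <;> grind
    · by_cases hwY : w ∈ Y
      · obtain ⟨S₁, S₂, k1, k2, k3, k4⟩ := hY.split hwY
        have k5 := k2.right_mem
        refine ⟨s, e', s', z, insert e' X, S₁ ∪ T, hX', k1.glue hT (by grind), ?_, hs, hs', ?_, ?_, hva,
          ?_, ?_, rfl, by grind⟩ <;> grind
      · rcases hva with hva | hva
        · refine ⟨s, e', w, z, insert e' X, T, hX', hT, ?_, hs, ?_, ?_, ?_, Or.inl hva,
            ?_, ?_, rfl, by grind⟩ <;> grind
        · refine ⟨s', e', w, z, Y, T, hY, hT, ?_, hs', ?_, ?_, ?_, Or.inl hva,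
            ?_, ?_, rfl, by grind⟩ <;> grind
  · refine ⟨s, vk, s', e', insert vk X, Y, hX', hY, ?_, hs, hs', ?_, hYA, hva, ?_, ?_, rfl, ?_⟩ <;>
      grind

/-- the final cycle -/
lemma TwoDisj.cycle {A Z L R : Finset V} {va vb : V} {c : ℕ} (hc : NoLong G c)
    (hAZ : ∀ x ∈ A, x ∈ Z → x = va ∧ x = vb)
    (h : TwoDisj G A Z va vb)
    (hL : ∀ s ∈ A, s ≠ va → ∃ L' ⊆ A, L ⊆ L' ∧ PS G s va L')
    (hR : ∀ s ∈ Z, s ≠ vb → ∃ R' ⊆ Z, R ⊆ R' ∧ PS G s vb R') :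
    (L ∪ R).card ≤ c := by
  obtain ⟨s, e, s', e', X, Y, hX, hY, hd, hs, hs', hXA, hYA, hva, hXZ, hYZ, rfl, he'⟩ := h
  have m1 := hX.left_mem
  have m2 := hX.right_mem
  have m3 := hY.left_mem
  have m4 := hY.right_mem
  obtain ⟨R', hR1, hR2, hR3⟩ := hR e' he' (by grind)
  have r1 := hR3.left_mem
  have r2 := hR3.right_mem
  have hLL : ∃ L' ⊆ A, L ⊆ L' ∧ PS G s' s L' := by
    rcases hva with rfl | rfl
    · exact hL s' hs' (by grind)
    · obtain ⟨L', a, b, d⟩ := hL s hs (by grind)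
      exact ⟨L', a, b, d.symm⟩
  obtain ⟨L', hL1, hL2, hL3⟩ := hLL
  have l1 := hL3.left_mem
  have l2 := hL3.right_mem
  have q1 := hL3.glue hX (by grind)
  have q2 := q1.glue hR3.symm (by grind)
  cases hY with
  | single => 
    exfalso
    grind
  | @cons _ w _ Y' a p hu =>
    have q3 := q2.glue p.symm (by grind)
    have := hc _ _ _ q3 a
    refine le_trans (Finset.card_le_card ?_) this
    grind

end

section
variable {V : Type} [DecidableEq V] {G : SimpleGraph V}

open Classical in
lemma posa_cross (v : ℕ → V) (m c : ℕ) (hinj : ∀ i ≤ m, ∀ j ≤ m, v i = v j → i = j)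
    (hadj : ∀ i < m, G.Adj (v i) (v (i+1))) (hc : NoLong G c) (hcm : c ≤ m)
    (hna : ¬ G.Adj (v 0) (v m)) (N M : Finset ℕ)
    (hN : ∀ i, i ∈ N ↔ i ≤ m ∧ G.Adj (v 0) (v i))
    (hM : ∀ i, i ∈ M ↔ i ≤ m ∧ G.Adj (v m) (v i))
    (hcard : c + 1 ≤ N.card + M.card)
    (hx : ∃ d i, 0 < d ∧ i ∈ M ∧ i + d ∈ N) : False := by
  obtain ⟨i, hd, hi, hj⟩ := Nat.find_spec hx
  have hmin := fun d (h : d < Nat.find hx) => Nat.find_min hx h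
  set d := Nat.find hx with hdd
  clear_value d
  have hi' := (hM i).1 hi
  have hj' := (hN (i+d)).1 hj
  have p1 := PS.seg v m hinj hadj 0 i (by omega)
  have p2 := PS.seg v m hinj hadj (i+d) (m-(i+d)) (by omega)
  rw [show i + d + (m-(i+d)) = m by omega] at p2
  simp only [zero_add] at p1
  have q := p2.append hi'.2 p1.symm (by
    intro x hx hx'
    simp only [Finset.mem_image, Finset.mem_Icc] at hx hx'
    obtain ⟨a, ha, rfl⟩ := hx
    obtain ⟨b, hb, hab⟩ := hx'
    have := hinj _ (by omega) _ (by omega) hab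
    omega)
  have hle := hc _ _ _ q hj'.2.symm
  rw [← Finset.image_union, Finset.card_image_of_injOn (by
    intro x hx y hy hxy
    simp at hx hy
    exact hinj _ (by omega) _ (by omega) hxy), Finset.card_union_of_disjoint (by
      rw [Finset.disjoint_left]; intro x hx hx'; simp at hx hx'; omega)] at hle
  simp only [Nat.card_Icc] at hle
  have hN0 : ∀ x ∈ N, 1 ≤ x ∧ x < m := by
    intro x hx
    have := (hN x).1 hx
    constructor
    · rcases Nat.eq_zero_or_pos x with rfl | h
      · exact absurd this.2 (G.irrefl)
      · exact h
    · rcases Nat.lt_or_ge x m with h | h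
      · exact h
      · have : x = m := by omega
        subst this; tauto
  have hM0 : ∀ x ∈ M, x < m := by
    intro x hx
    have := (hM x).1 hx
    rcases Nat.lt_or_ge x m with h | h
    · exact h
    · have : x = m := by omega
      subst this; exact absurd this.2 (G.irrefl)
  have hd2 : 2 ≤ d := by
    by_contra h
    have : d = 1 := by omega
    subst this
    omega
  set N' := N.image (fun x => x - 1) with hN'
  have hNc : N'.card = N.card := by
    apply Finset.card_image_of_injOn
    intro x hx y hy hxy
    have := hN0 x hx; have := hN0 y hy
    simp only at hxy; omega
  have hmem : ∀ s, s ∈ N' → s + 1 ∈ N := by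
    intro s hs
    rw [hN', Finset.mem_image] at hs
    obtain ⟨x, hx, rfl⟩ := hs
    have := hN0 x hx
    rwa [show x - 1 + 1 = x by omega]
  have hdisj : Disjoint N' M := by
    rw [Finset.disjoint_left]
    intro s hs hs'
    exact hmin 1 (by omega) ⟨s, by omega, hs', hmem s hs⟩
  have hdisj2 : Disjoint (N' ∪ M) (Finset.Icc (i+1) (i+d-2)) := by
    rw [Finset.disjoint_left]
    intro s hs hs'
    simp only [Finset.mem_union, Finset.mem_Icc] at hs hs'
    rcases hs with hs | hs
    · refine hmin (s+1-i) (by omega) ⟨i, by omega, hi, ?_⟩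
      rw [show i + (s+1-i) = s+1 by omega]; exact hmem s hs
    · refine hmin (i+d-s) (by omega) ⟨s, by omega, hs, ?_⟩
      rw [show s + (i+d-s) = i+d by omega]; exact hj
  have hsub : (N' ∪ M) ∪ (Finset.Icc (i+1) (i+d-2)) ⊆ Finset.range m := by
    intro s hs
    simp only [Finset.mem_union, Finset.mem_Icc, Finset.mem_range] at hs ⊢
    rcases hs with (hs | hs) | hs
    · have := hN0 _ (hmem s hs); omega
    · exact hM0 s hs
    · omega
  have := Finset.card_le_card hsub
  rw [Finset.card_union_of_disjoint hdisj2, Finset.card_union_of_disjoint hdisj] at this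
  simp at this
  omega

lemma posa_left (v : ℕ → V) (m : ℕ) (hinj : ∀ i ≤ m, ∀ j ≤ m, v i = v j → i = j)
    (hadj : ∀ i < m, G.Adj (v i) (v (i+1))) (N : Finset ℕ)
    (hN : ∀ i, i ∈ N ↔ i ≤ m ∧ G.Adj (v 0) (v i)) (a : ℕ) (ha : a ∈ N)
    (hmax : ∀ i ∈ N, i ≤ a) :
    ∀ s ∈ (Finset.Icc 0 a).image v, s ≠ v a → ∃ L' ⊆ (Finset.Icc 0 a).image v,
      (insert 0 N).image v ⊆ L' ∧ PS G s (v a) L' := by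
  intro s hs hsa
  simp only [Finset.mem_image, Finset.mem_Icc] at hs
  obtain ⟨p, hp, rfl⟩ := hs
  have hpa : p < a := by
    rcases Nat.lt_or_ge p a with h | h
    · exact h
    · have : p = a := by omega
      subst this; tauto
  have hex : ∃ q, p < q ∧ q ∈ N := ⟨a, hpa, ha⟩
  classical
  obtain ⟨hq1, hq2⟩ := Nat.find_spec hex
  have hmin := fun d (h : d < Nat.find hex) => Nat.find_min hex h
  set q := Nat.find hex
  clear_value q
  have hqa := hmax q hq2
  have ham := ((hN a).1 ha).1
  have p1 := PS.seg v m hinj hadj 0 p (by omega)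
  have p2 := PS.seg v m hinj hadj q (a-q) (by omega)
  rw [show q + (a - q) = a by omega] at p2
  simp only [zero_add] at p1
  have r := p1.symm.append ((hN q).1 hq2).2 p2 (by
    intro x hx hx'
    simp only [Finset.mem_image, Finset.mem_Icc] at hx hx'
    obtain ⟨a, ha, rfl⟩ := hx
    obtain ⟨b, hb, hab⟩ := hx'
    have := hinj _ (by omega) _ (by omega) hab
    omega)
  rw [← Finset.image_union] at r
  refine ⟨_, Finset.image_subset_image ?_, Finset.image_subset_image ?_, r⟩
  · intro x; simp; omega
  · intro x hx
    simp only [Finset.mem_insert, Finset.mem_union, Finset.mem_Icc] at hx ⊢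
    rcases hx with rfl | hx
    · omega
    · by_contra h
      have := hmax x hx
      exact hmin x (by omega) ⟨by omega, hx⟩

lemma posa_two (hG : TC G) (v : ℕ → V) (m : ℕ) (hinj : ∀ i ≤ m, ∀ j ≤ m, v i = v j → i = j)
    (hadj : ∀ i < m, G.Adj (v i) (v (i+1))) (a d : ℕ) (ha : 0 < a) (hm : a + d < m) :
    TwoDisj G ((Finset.Icc 0 a).image v) ((Finset.Icc (a+d) m).image v) (v a) (v (a+d)) := by
  induction d with
  | zero =>
    have e1 : v 0 ≠ v a := fun h => by have := hinj _ (by omega) _ (by omega) h; omega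
    have e2 : v m ≠ v a := fun h => by have := hinj _ (by omega) _ (by omega) h; omega
    obtain ⟨S, hS, hkS⟩ := hG (v a) (v 0) (v m) e1 e2
    obtain ⟨w, z, T, hT, hTS, hwA, hzZ, hTA, hTZ⟩ :=
      hS.hit2 (A := ((Finset.Icc 0 a).image v).erase (v a))
        (B := ((Finset.Icc a m).image v).erase (v a)) (by
          rw [Finset.mem_erase]; exact ⟨e1, Finset.mem_image_of_mem _ (by simp)⟩) (by
          rw [Finset.mem_erase]; exact ⟨e2, Finset.mem_image_of_mem _ (by simp; omega)⟩)
    have h1 : v a ∈ (Finset.Icc 0 a).image v := Finset.mem_image_of_mem _ (by simp)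
    have h2 : v a ∈ (Finset.Icc a m).image v := Finset.mem_image_of_mem _ (by simp; omega)
    simp only [add_zero]
    refine ⟨v a, v a, w, z, {v a}, T, PS.single _, hT, ?_, h1, ?_, ?_, ?_, Or.inl rfl, ?_, ?_,
      rfl, ?_⟩ <;> grind
  | succ d ih =>
    have ih := ih (by omega)
    have e1 : (Finset.Icc (a+d) m).image v = insert (v (a+d)) (insert (v (a+(d+1)))
        ((Finset.Icc (a+d+2) m).image v)) := by
      rw [← Finset.image_insert, ← Finset.image_insert]
      congr 1
      ext x; simp; omega
    have e2 : (Finset.Icc (a+(d+1)) m).image v = insert (v (a+(d+1)))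
        ((Finset.Icc (a+d+2) m).image v) := by
      rw [← Finset.image_insert]
      congr 1
      ext x; simp; omega
    rw [e1] at ih
    rw [e2]
    refine TwoDisj.step hG (hadj (a+d) (by omega)) ?_ ?_ ?_ ?_ ?_ ih
    · rw [← e2]
      intro h
      simp only [Finset.mem_image, Finset.mem_Icc] at h
      obtain ⟨x, hx, h⟩ := h
      have := hinj _ (by omega) _ (by omega) h; omega
    · intro h
      simp only [Finset.mem_image, Finset.mem_Icc] at h
      obtain ⟨x, hx, h⟩ := h
      have := hinj _ (by omega) _ (by omega) h; omega
    · intro h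
      simp only [Finset.mem_image, Finset.mem_Icc] at h
      obtain ⟨x, hx, h⟩ := h
      have := hinj _ (by omega) _ (by omega) h; omega
    · intro y hy h
      simp only [Finset.mem_image, Finset.mem_Icc] at h hy
      obtain ⟨x, hx, h⟩ := h
      obtain ⟨x', hx', rfl⟩ := hy
      have := hinj _ (by omega) _ (by omega) h; omega
    · refine ⟨v m, Finset.mem_image_of_mem _ (by simp; omega)⟩

lemma posa (hG : TC G) (v : ℕ → V) (m c : ℕ) (hinj : ∀ i ≤ m, ∀ j ≤ m, v i = v j → i = j)
    (hadj : ∀ i < m, G.Adj (v i) (v (i+1))) (hc : NoLong G c) (hcm : c ≤ m) (hm1 : 0 < m)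
    (hna : ¬ G.Adj (v 0) (v m)) (N M : Finset ℕ)
    (hN : ∀ i, i ∈ N ↔ i ≤ m ∧ G.Adj (v 0) (v i))
    (hM : ∀ i, i ∈ M ↔ i ≤ m ∧ G.Adj (v m) (v i))
    (hcard : c + 1 ≤ N.card + M.card) : False := by
  by_cases hx : ∃ d i, 0 < d ∧ i ∈ M ∧ i + d ∈ N
  · exact posa_cross v m c hinj hadj hc hcm hna N M hN hM hcard hx
  have hno : ∀ i ∈ M, ∀ j ∈ N, j ≤ i := by
    intro i hi j hj
    by_contra h
    exact hx ⟨j - i, i, by omega, hi, by rwa [show i + (j-i) = j by omega]⟩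
  have h1N : 1 ∈ N := (hN 1).2 ⟨hm1, hadj 0 hm1⟩
  have hmM : m - 1 ∈ M := (hM _).2 ⟨by omega, by
    have := hadj (m-1) (by omega)
    rw [show m - 1 + 1 = m by omega] at this
    exact this.symm⟩
  set a := N.max' ⟨1, h1N⟩ with ha
  set b := M.min' ⟨_, hmM⟩ with hb
  have haN : a ∈ N := Finset.max'_mem _ _
  have hbM : b ∈ M := Finset.min'_mem _ _
  have hamax : ∀ i ∈ N, i ≤ a := fun i hi => Finset.le_max' _ _ hi
  have hbmin : ∀ i ∈ M, b ≤ i := fun i hi => Finset.min'_le _ _ hi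
  have hab := hno b hbM a haN
  have ha1 := hamax 1 h1N
  have hbm := hbmin _ hmM
  have tw := posa_two hG v m hinj hadj a (b - a) (by omega) (by omega)
  rw [show a + (b - a) = b by omega] at tw
  have hL := posa_left v m hinj hadj N hN a haN hamax
  have hR := posa_left (G := G) (fun i => v (m - i)) m
    (fun i hi j hj h => by have := hinj _ (by omega) _ (by omega) h; omega)
    (fun i hi => by
      have := hadj (m-(i+1)) (by omega)
      rw [show m - (i+1) + 1 = m - i by omega] at this
      exact this.symm) (M.image (fun i => m - i)) (by
      intro i
      simp only [Finset.mem_image, Nat.sub_zero]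
      constructor
      · rintro ⟨j, hj, rfl⟩
        have := (hM j).1 hj
        rw [show m - (m - j) = j by omega]
        exact ⟨by omega, this.2⟩
      · rintro ⟨hi, h⟩
        exact ⟨m - i, (hM _).2 ⟨by omega, h⟩, by omega⟩) (m - b)
      (Finset.mem_image_of_mem (fun i => m - i) hbM) (by
      intro i hi
      simp only [Finset.mem_image] at hi
      obtain ⟨j, hj, rfl⟩ := hi
      have := hbmin j hj
      omega)
  have i1 : (Finset.Icc 0 (m-b)).image (fun i => v (m - i)) = (Finset.Icc b m).image v := by
    ext x
    simp only [Finset.mem_image, Finset.mem_Icc]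
    constructor
    · rintro ⟨j, hj, rfl⟩; exact ⟨m - j, by omega, rfl⟩
    · rintro ⟨j, hj, rfl⟩; exact ⟨m - j, by omega, by rw [show m - (m - j) = j by omega]⟩
  have i2 : (insert 0 (M.image (fun i => m - i))).image (fun i => v (m - i)) =
      (insert m M).image v := by
    rw [Finset.image_insert, Finset.image_insert, Finset.image_image, Nat.sub_zero]
    congr 1
    apply Finset.image_congr
    intro j hj
    have := ((hM j).1 hj).1
    simp only [Function.comp]
    rw [show m - (m - j) = j by omega]
  rw [i1, i2] at hR
  simp only [show m - (m - b) = b by omega] at hR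
  have := TwoDisj.cycle hc (by
    intro x hx hx'
    simp only [Finset.mem_image, Finset.mem_Icc] at hx hx'
    obtain ⟨i, hi, rfl⟩ := hx
    obtain ⟨j, hj, h⟩ := hx'
    have := hinj _ (by omega) _ (by omega) h
    have e1 : i = a := by omega
    have e2 : i = b := by omega
    exact ⟨by rw [e1], by rw [e2]⟩) tw hL hR
  have hbd : ∀ x ∈ insert 0 N ∪ insert m M, x ≤ m := by
    intro x hx
    simp only [Finset.mem_union, Finset.mem_insert] at hx
    rcases hx with (rfl | h) | (rfl | h)
    · omega
    · exact ((hN _).1 h).1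
    · exact le_rfl
    · exact ((hM _).1 h).1
  rw [← Finset.image_union, Finset.card_image_of_injOn (by
    intro x hx y hy hxy
    exact hinj _ (hbd x hx) _ (hbd y hy) hxy)] at this
  have n1 : 0 ∉ N := fun h => G.irrefl ((hN _).1 h).2
  have n2 : m ∉ M := fun h => G.irrefl ((hM _).1 h).2
  have c1 : (insert 0 N).card = N.card + 1 := Finset.card_insert_of_notMem n1
  have c2 : (insert m M).card = M.card + 1 := Finset.card_insert_of_notMem n2
  have c3 := Finset.card_union_add_card_inter (insert 0 N) (insert m M)
  have c4 : ((insert 0 N) ∩ (insert m M)) ⊆ {a} := by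
    intro x hx
    simp only [Finset.mem_inter, Finset.mem_insert, Finset.mem_singleton] at hx ⊢
    obtain ⟨h | h, h' | h'⟩ := hx
    · omega
    · have := hno x h' 1 h1N; omega
    · have := hno _ hmM x h; omega
    · have := hno _ h' _ haN
      have := hamax x h; omega
  have c5 := Finset.card_le_card c4
  simp at c5
  omega

lemma posa_path (hG : TC G) {c : ℕ} (hc : NoLong G c) {x y : V} {S : Finset V}
    (hS : PS G x y S) (hcS : c + 1 ≤ S.card) (hne : x ≠ y) (hna : ¬ G.Adj x y) (A B : Finset V)
    (hA : A ⊆ S) (hB : B ⊆ S) (hxA : ∀ z ∈ A, G.Adj x z) (hyB : ∀ z ∈ B, G.Adj y z)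
    (hcard : c + 1 ≤ A.card + B.card) : False := by
  classical
  obtain ⟨p, hp, hpS⟩ := hS.to_walk
  set N := (Finset.range (p.length + 1)).filter (fun i => G.Adj x (p.getVert i)) with hN
  set M := (Finset.range (p.length + 1)).filter (fun i => G.Adj y (p.getVert i)) with hM
  have hSc : S.card = p.length + 1 := by
    rw [← hpS, List.toFinset_card_of_nodup hp.support_nodup, Walk.length_support]
  have hAN : A ⊆ N.image p.getVert := by
    intro z hz
    have h1 := hA hz
    rw [← hpS, List.mem_toFinset, Walk.mem_support_iff_exists_getVert] at h1
    obtain ⟨i, hi, hi'⟩ := h1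
    refine Finset.mem_image.2 ⟨i, ?_, hi⟩
    rw [hN, Finset.mem_filter, hi]
    exact ⟨by simp; omega, hxA z hz⟩
  have hBM : B ⊆ M.image p.getVert := by
    intro z hz
    have h1 := hB hz
    rw [← hpS, List.mem_toFinset, Walk.mem_support_iff_exists_getVert] at h1
    obtain ⟨i, hi, hi'⟩ := h1
    refine Finset.mem_image.2 ⟨i, ?_, hi⟩
    rw [hM, Finset.mem_filter, hi]
    exact ⟨by simp; omega, hyB z hz⟩
  have k1 := (Finset.card_le_card hAN).trans Finset.card_image_le
  have k2 := (Finset.card_le_card hBM).trans Finset.card_image_le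
  have hl : 0 < p.length := by
    rcases Nat.eq_zero_or_pos p.length with h | h
    · exact absurd (Walk.eq_of_length_eq_zero h) hne
    · exact h
  refine posa hG p.getVert p.length c ?_ ?_ hc (by omega) hl (by simpa using hna) N M ?_ ?_
    (by omega)
  · intro i hi j hj h
    exact hp.getVert_injOn hi hj h
  · intro i hi
    exact p.adj_getVert_succ hi
  · intro i; simp [hN]
  · intro i; simp [hM]

/-- the key adjacency lemma -/
lemma key_adj [Fintype V] (hG : TC G) {c : ℕ} (hc : NoLong G c)
    (hmax : ∀ x y, x ≠ y → ¬ G.Adj x y → ∃ S, PS G x y S ∧ c + 1 ≤ S.card)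
    [DecidableRel G.Adj] (A B : Finset V) (p q : ℕ)
    (hA : ∀ x ∈ A, p ≤ (A.filter (G.Adj x)).card) (hB : ∀ x ∈ B, q ≤ (B.filter (G.Adj x)).card)
    (hpq : c + 1 ≤ p + q) : ∀ x ∈ A, ∀ y ∈ B, x ≠ y → G.Adj x y := by
  by_contra hcon
  push Not at hcon
  obtain ⟨x0, hx0, y0, hy0, hne0, hna0⟩ := hcon
  obtain ⟨S0, hS0, hcS0⟩ := hmax _ _ hne0 hna0
  classical
  set F : Finset (Finset V) := Finset.univ.filter
    (fun S => ∃ x ∈ A, ∃ y ∈ B, x ≠ y ∧ ¬ G.Adj x y ∧ PS G x y S) with hF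
  have hF0 : S0 ∈ F := by
    rw [hF, Finset.mem_filter]
    exact ⟨Finset.mem_univ _, x0, hx0, y0, hy0, hne0, hna0, hS0⟩
  obtain ⟨S, hSF, hSmax⟩ := Finset.exists_max_image F Finset.card ⟨_, hF0⟩
  have hSc : c + 1 ≤ S.card := hcS0.trans (hSmax _ hF0)
  obtain ⟨-, x, hx, y, hy, hne, hna, hS⟩ := Finset.mem_filter.1 hSF
  refine posa_path hG hc hS hSc hne hna (A.filter (G.Adj x)) (B.filter (G.Adj y)) ?_ ?_ ?_ ?_ ?_
  · intro w hw
    by_contra hwS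
    obtain ⟨hwA, hxw⟩ := Finset.mem_filter.1 hw
    have hp := PS.cons hxw.symm hS hwS
    by_cases hwy : G.Adj w y
    · have := hc _ _ _ hp hwy
      rw [Finset.card_insert_of_notMem hwS] at this; omega
    · have := hSmax (insert w S) (by
        rw [hF, Finset.mem_filter]
        refine ⟨Finset.mem_univ _, w, hwA, y, hy, ?_, hwy, hp⟩
        rintro rfl; exact hwS hS.right_mem)
      rw [Finset.card_insert_of_notMem hwS] at this; omega
  · intro w hw
    by_contra hwS
    obtain ⟨hwA, hxw⟩ := Finset.mem_filter.1 hw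
    have hp := hS.snoc hxw hwS
    by_cases hwy : G.Adj x w
    · have := hc _ _ _ hp hwy
      rw [Finset.card_insert_of_notMem hwS] at this; omega
    · have := hSmax (insert w S) (by
        rw [hF, Finset.mem_filter]
        refine ⟨Finset.mem_univ _, x, hx, w, hwA, ?_, hwy, hp⟩
        rintro rfl; exact hwS hS.left_mem)
      rw [Finset.card_insert_of_notMem hwS] at this; omega
  · intro z hz; exact (Finset.mem_filter.1 hz).2
  · intro z hz; exact (Finset.mem_filter.1 hz).2
  · have := hA x hx; have := hB y hy; omega

end

section
variable {V : Type} [DecidableEq V] {G : SimpleGraph V} [DecidableRel G.Adj]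

/-- twice the number of edges inside `U` -/
def dd (G : SimpleGraph V) [DecidableRel G.Adj] (U : Finset V) : ℕ :=
  ∑ x ∈ U, (U.filter (G.Adj x)).card

lemma dd_erase (U : Finset V) (x : V) (hx : x ∈ U) :
    dd G U = dd G (U.erase x) + 2 * (U.filter (G.Adj x)).card := by
  unfold dd
  rw [← Finset.add_sum_erase _ _ hx]
  have h : ∀ y ∈ U.erase x, (U.filter (G.Adj y)).card =
      ((U.erase x).filter (G.Adj y)).card + if G.Adj x y then 1 else 0 := by
    intro y hy
    rw [Finset.filter_erase]
    split_ifs with h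
    · rw [Finset.card_erase_add_one]
      simp [hx, h.symm]
    · rw [Finset.erase_eq_of_notMem]
      · simp
      · simp [hx, G.adj_comm y x, h]
  rw [Finset.sum_congr rfl h, Finset.sum_add_distrib, ← Finset.card_filter]
  have : (U.erase x).filter (G.Adj x) = U.filter (G.Adj x) := by
    ext y; simp; rintro h - rfl; exact G.irrefl h
  rw [this]; ring

lemma dd_le (U : Finset V) : dd G U ≤ U.card * (U.card - 1) := by
  unfold dd
  rw [← smul_eq_mul]
  apply Finset.sum_le_card_nsmul
  intro x hx
  rw [← Finset.card_erase_of_mem hx]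
  apply Finset.card_le_card
  intro y hy
  simp at hy ⊢
  exact ⟨fun h => G.irrefl (h ▸ hy.2), hy.1⟩

/-- existence of the core -/
lemma exists_core [Fintype V] (s : ℕ) : ∃ H : Finset V,
    (∀ x ∈ H, s + 1 ≤ (H.filter (G.Adj x)).card) ∧
    ∀ T : Finset V, (∀ x ∈ T, s + 1 ≤ (T.filter (G.Adj x)).card) → T ⊆ H := by
  classical
  refine ⟨Finset.univ.filter (fun v => ∃ T : Finset V,
    (∀ x ∈ T, s + 1 ≤ (T.filter (G.Adj x)).card) ∧ v ∈ T), ?_, ?_⟩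
  · intro x hx
    simp only [Finset.mem_filter, Finset.mem_univ, true_and] at hx
    obtain ⟨T, hT, hxT⟩ := hx
    refine (hT x hxT).trans (Finset.card_le_card ?_)
    intro y hy
    simp only [Finset.mem_filter, Finset.mem_univ, true_and] at hy ⊢
    exact ⟨⟨T, hT, hy.1⟩, hy.2⟩
  · intro T hT x hx
    simp only [Finset.mem_filter, Finset.mem_univ, true_and]
    exact ⟨T, hT, hx⟩

lemma dd_core (s : ℕ) (H : Finset V) (hH : ∀ x ∈ H, s + 1 ≤ (H.filter (G.Adj x)).card)
    (hmax : ∀ T : Finset V, (∀ x ∈ T, s + 1 ≤ (T.filter (G.Adj x)).card) → T ⊆ H)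
    (d : ℕ) : ∀ U : Finset V, H ⊆ U → U.card = H.card + d → dd G U ≤ dd G H + 2 * s * d := by
  induction d with
  | zero =>
    intro U hU hc
    rw [Finset.eq_of_subset_of_card_le hU (by omega)]; simp
  | succ d ih =>
    intro U hU hc
    have : ∃ x ∈ U, (U.filter (G.Adj x)).card ≤ s := by
      by_contra h
      push Not at h
      have := Finset.card_le_card (hmax U (fun x hx => h x hx))
      omega
    obtain ⟨x, hx, hxs⟩ := this
    have hxH : x ∉ H := by
      intro h
      have := hH x h
      have := Finset.card_le_card (Finset.filter_subset_filter (G.Adj x) hU)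
      omega
    have e := dd_erase (G := G) U x hx
    have := ih (U.erase x) (Finset.subset_erase.2 ⟨hU, hxH⟩)
      (by rw [Finset.card_erase_of_mem hx]; omega)
    rw [e]
    nlinarith

lemma dd_empty (s : ℕ)
    (hmax : ∀ T : Finset V, (∀ x ∈ T, s + 1 ≤ (T.filter (G.Adj x)).card) → T ⊆ ∅)
    (d : ℕ) : ∀ U : Finset V, U.card = s + 1 + d → dd G U ≤ (s + 1) * s + 2 * s * d := by
  induction d with
  | zero =>
    intro U hc
    have := dd_le (G := G) U
    rw [hc] at this
    simpa using this
  | succ d ih =>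
    intro U hc
    have : ∃ x ∈ U, (U.filter (G.Adj x)).card ≤ s := by
      by_contra h
      push Not at h
      have := Finset.card_le_card (hmax U (fun x hx => h x hx))
      rw [Finset.card_empty] at this
      omega
    obtain ⟨x, hx, hxs⟩ := this
    have e := dd_erase (G := G) U x hx
    have := ih (U.erase x) (by rw [Finset.card_erase_of_mem hx]; omega)
    rw [e]
    nlinarith

/-- numeric: `2 * f(n,c,k)` -/
lemma two_f (n c k : ℕ) (hk : k ≤ c) (hn : c + 1 ≤ n) :
    (2 * fCliques n c k 2 : ℤ) = ((c:ℤ) + 1 - k) * (c - k) + 2 * k * (n - c - 1 + k) := by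
  unfold fCliques
  have h1 : 2 * (c + 1 - k).choose 2 = (c + 1 - k) * (c - k) := by
    rw [Nat.choose_two_right, Nat.mul_div_cancel']
    · congr 1; omega
    · exact (Nat.even_mul_pred_self _).two_dvd
  have h2 : ((2 * (c + 1 - k).choose 2 : ℕ) : ℤ) = ((c:ℤ) + 1 - k) * (c - k) := by
    rw [h1]; push_cast [show k ≤ c + 1 by omega, hk]; ring
  push_cast at h2
  have h3 : ((n + k - c - 1 : ℕ) : ℤ) = n - c - 1 + k := by omega
  simp only [Nat.add_one_sub_one, Nat.choose_one_right]
  push_cast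
  rw [mul_add, h2, h3]
  ring

lemma conv_f (n c k : ℕ) (hk2 : 2 ≤ k) (hk : k ≤ c / 2) (hn : c + 1 ≤ n) :
    fCliques n c k 2 ≤ max (fCliques n c 2 2) (fCliques n c (c / 2) 2) := by
  by_contra h
  push Not at h
  obtain ⟨h1, h2⟩ := max_lt_iff.1 h
  have e1 := two_f n c k (by omega) hn
  have e2 := two_f n c 2 (by omega) hn
  have e3 := two_f n c (c/2) (by omega) hn
  set t := c / 2
  set A := fCliques n c k 2
  set B := fCliques n c 2 2
  set C := fCliques n c t 2
  have h1' : (B:ℤ) < A := by exact_mod_cast h1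
  have h2' : (C:ℤ) < A := by exact_mod_cast h2
  clear_value A B C
  have g1 : (2:ℤ) ≤ k := by exact_mod_cast hk2
  have g2 : (k:ℤ) ≤ t := by exact_mod_cast hk
  clear_value t
  push_cast at e2
  have k2 : (2:ℤ) < k := by
    rcases lt_or_eq_of_le g1 with h | h
    · exact h
    · exfalso; rw [← h] at e1; linarith
  have k3 : (k:ℤ) < t := by
    rcases lt_or_eq_of_le g2 with h | h
    · exact h
    · exfalso; rw [← h] at e3; linarith
  generalize (k:ℤ) = k at *
  generalize (t:ℤ) = t at *
  generalize (n:ℤ) = n at *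
  generalize (c:ℤ) = c at *
  have f1 : 0 < (k - 2) * (3 * (k + 2) + (2 * n - 4 * c - 3)) := by nlinarith
  have f2 : 0 < (t - k) * (-(3 * (k + t) + (2 * n - 4 * c - 3))) := by nlinarith
  have f3 := pos_of_mul_pos_right f1 (by linarith)
  have f4 := pos_of_mul_pos_right f2 (by linarith)
  linarith

lemma TC.deg [Fintype V] (hG : TC G) (h3 : 3 ≤ Fintype.card V) (x : V) :
    2 ≤ ((Finset.univ : Finset V).filter (G.Adj x)).card := by
  have nb : ∀ c, c ≠ x → ∃ w, w ≠ c ∧ G.Adj x w := by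
    intro c hcx
    have : ∃ y, y ≠ c ∧ y ≠ x := by
      by_contra h
      push Not at h
      have : (Finset.univ : Finset V) ⊆ {c, x} := by
        intro y _; simp; have := h y; tauto
      have := (Finset.card_le_card this).trans Finset.card_le_two
      rw [Finset.card_univ] at this; omega
    obtain ⟨y, hyc, hyx⟩ := this
    obtain ⟨S, hS, hcS⟩ := hG c x y hcx.symm hyc
    cases hS with
    | single => exact absurd rfl hyx
    | @cons _ w _ S' a p hu =>
      have := p.left_mem
      exact ⟨w, by grind, a⟩
  have : ∃ c, c ≠ x := by
    have : Nontrivial V := Fintype.one_lt_card_iff_nontrivial.1 (by omega)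
    exact exists_ne x
  obtain ⟨c, hc⟩ := this
  obtain ⟨w1, -, h1⟩ := nb c hc
  obtain ⟨w2, h2, h2'⟩ := nb w1 h1.ne'
  have : ({w1, w2} : Finset V) ⊆ (Finset.univ : Finset V).filter (G.Adj x) := by
    intro y hy; simp at hy ⊢; rcases hy with rfl | rfl <;> assumption
  have := Finset.card_le_card this
  rwa [Finset.card_pair h2.symm] at this

lemma kopylov_max [Fintype V] (hG : TC G) {c n : ℕ} (hc : NoLong G c) (h4 : 4 ≤ c)
    (hn : c + 1 ≤ n) (hV : Fintype.card V = n)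
    (hmax : ∀ x y, x ≠ y → ¬ G.Adj x y → ∃ S, PS G x y S ∧ c + 1 ≤ S.card) :
    dd G Finset.univ ≤ 2 * max (fCliques n c 2 2) (fCliques n c (c / 2) 2) := by
  obtain ⟨H, hH, hHmax⟩ := exists_core (G := G) (c / 2)
  set t := c / 2 with ht
  have hcn : (Finset.univ : Finset V).card = n := by rw [Finset.card_univ, hV]
  rcases Finset.eq_empty_or_nonempty H with rfl | hne
  · have := dd_empty (G := G) t hHmax (n - (t + 1)) Finset.univ (by omega)
    refine this.trans (le_trans ?_ (Nat.mul_le_mul_left 2 (le_max_right _ _)))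
    have e := two_f n c t (by omega) hn
    zify
    rw [e]
    push_cast [show t + 1 ≤ n by omega]
    have : (c:ℤ) = 2 * t ∨ (c:ℤ) = 2 * t + 1 := by omega
    rcases this with h | h <;> rw [h] <;> nlinarith
  have hcl : ∀ x ∈ H, ∀ y ∈ H, x ≠ y → G.Adj x y :=
    key_adj hG hc hmax H H (t+1) (t+1) hH hH (by omega)
  set r := H.card with hr
  have hrt : t + 2 ≤ r := by
    obtain ⟨x, hx⟩ := hne
    have h1 := hH x hx
    have : H.filter (G.Adj x) ⊆ H.erase x := by
      intro y hy
      simp at hy ⊢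
      exact ⟨fun h => G.irrefl (h ▸ hy.2), hy.1⟩
    have := Finset.card_le_card this
    rw [Finset.card_erase_of_mem hx] at this
    omega
  have hrc : r ≤ c := by
    obtain ⟨x, hx, y, hy, hxy⟩ := Finset.one_lt_card.1 (show 1 < H.card by omega)
    exact hc _ _ _ (PS.clique H x hx y hy hxy hcl) (hcl x hx y hy hxy)
  have hHd : ∀ x ∈ H, r - 1 ≤ (H.filter (G.Adj x)).card := by
    intro x hx
    rw [hr, ← Finset.card_erase_of_mem hx]
    apply Finset.card_le_card
    intro y hy
    simp at hy ⊢
    exact ⟨hy.2, hcl x hx y hy.2 (Ne.symm hy.1)⟩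
  obtain ⟨H', hH', hH'max⟩ := exists_core (G := G) (c + 1 - r)
  have hsub : H ⊆ H' := by
    apply hH'max
    intro x hx
    have := hH x hx
    omega
  have hall : ∀ x ∈ H, ∀ y ∈ H', x ≠ y → G.Adj x y :=
    key_adj hG hc hmax H H' (r - 1) (c + 1 - r + 1) hHd hH' (by omega)
  have heq : H' = H := by
    apply Finset.Subset.antisymm _ hsub
    intro y hy
    by_contra hyH
    have : insert y H ⊆ H := by
      apply hHmax
      intro x hx
      rcases Finset.mem_insert.1 hx with rfl | hx
      · have : H ⊆ (insert x H).filter (G.Adj x) := by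
          intro z hz
          simp only [Finset.mem_filter, Finset.mem_insert]
          exact ⟨Or.inr hz, (hall z hz x hy (by rintro rfl; exact hyH hz)).symm⟩
        have := Finset.card_le_card this
        omega
      · exact (hH x hx).trans (Finset.card_le_card
          (Finset.filter_subset_filter _ (Finset.subset_insert _ _)))
    exact hyH (this (Finset.mem_insert_self _ _))
  subst heq
  have hk2 : 2 ≤ c + 1 - r := by
    by_contra h
    have h1 : c + 1 - r = 1 := by omega
    have := hH'max Finset.univ (fun x _ => by
      have := TC.deg hG (by omega) x
      omega)
    have := Finset.card_le_card this
    omega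
  have hb := dd_core (G := G) (c + 1 - r) H' hH' hH'max (n - r) Finset.univ
    (Finset.subset_univ _) (by
      have := Finset.card_le_card hsub
      have := Finset.card_le_univ H'
      omega)
  have hcf := conv_f n c (c + 1 - r) hk2 (by omega) hn
  refine le_trans ?_ (Nat.mul_le_mul_left 2 hcf)
  have hd := dd_le (G := G) H'
  have e := two_f n c (c + 1 - r) (by omega) hn
  rw [← hr] at hd
  clear_value r
  have hk : ((c + 1 - r : ℕ) : ℤ) = c + 1 - r := by omega
  have hnr : ((n - r : ℕ) : ℤ) = n - r := by omega
  have hr1 : ((r - 1 : ℕ) : ℤ) = r - 1 := by omega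
  zify at hb hd ⊢
  rw [hk] at e hb
  rw [hnr] at hb
  rw [hr1] at hd
  rw [e]
  nlinarith

lemma exists_max [Fintype V] (c : ℕ) (h2 : 2 ≤ c) (hc : NoLong G c) : ∃ G' : SimpleGraph V, G ≤ G' ∧ NoLong G' c ∧
    ∀ x y, x ≠ y → ¬ G'.Adj x y → ∃ S, PS G' x y S ∧ c + 1 ≤ S.card := by
  obtain ⟨G', hle, hG'⟩ := (Set.toFinite {K : SimpleGraph V | NoLong K c}).exists_le_maximal
    (a := G) hc
  refine ⟨G', hle, hG'.1, ?_⟩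
  intro x y hxy hna
  have hK : ¬ NoLong (G' ⊔ edge x y) c := by
    intro h
    have h1 := hG'.2 h le_sup_left
    exact hna (h1 (Or.inr ((edge_adj _ _ _ _).2 ⟨Or.inl ⟨rfl, rfl⟩, hxy⟩)))
  unfold NoLong at hK
  push Not at hK
  obtain ⟨a, b, S, hS, hab, hcS⟩ := hK
  have hab' : G'.Adj a b ∨ (a = x ∧ b = y) ∨ (a = y ∧ b = x) := by
    rw [SimpleGraph.sup_adj, SimpleGraph.edge_adj] at hab
    tauto
  have hself : ∀ z T, PS G' z z T → T = {z} := by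
    intro z T h
    cases h with
    | single => rfl
    | cons a p hu => exact absurd p.right_mem hu
  rcases hS.add_edge with h | ⟨S₁, S₂, e, hd, h⟩
  · rcases hab' with hab' | ⟨rfl, rfl⟩ | ⟨rfl, rfl⟩
    · have := hG'.1 _ _ _ h hab'; omega
    · exact ⟨S, h, hcS⟩
    · exact ⟨S, h.symm, hcS⟩
  · rcases hab' with hab' | ⟨rfl, rfl⟩ | ⟨rfl, rfl⟩
    · rcases h with ⟨h, h'⟩ | ⟨h, h'⟩
      · refine ⟨S, ?_, hcS⟩
        rw [← e]
        exact h.symm.append hab' h'.symm hd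
      · refine ⟨S, ?_, hcS⟩
        rw [← e]
        exact (h.symm.append hab' h'.symm hd).symm
    · exfalso
      rcases h with ⟨h, h'⟩ | ⟨h, h'⟩
      · rw [hself _ _ h, hself _ _ h'] at e
        rw [← e] at hcS
        have : (({a} : Finset V) ∪ {b}).card ≤ 2 := Finset.card_le_two
        omega
      · exact hd _ h.left_mem h'.left_mem
    · exfalso
      rcases h with ⟨h, h'⟩ | ⟨h, h'⟩
      · exact hd _ h.left_mem h'.left_mem
      · rw [hself _ _ h, hself _ _ h'] at e
        rw [← e] at hcS
        have : (({a} : Finset V) ∪ {b}).card ≤ 2 := Finset.card_le_two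
        omega

end

lemma TwoConnected.tc {V : Type} [DecidableEq V] {G : SimpleGraph V} (h : TwoConnected G) :
    TC G := by
  intro c a b ha hb
  obtain ⟨w⟩ := (h.2 c).preconnected ⟨a, ha⟩ ⟨b, hb⟩
  have hp := w.bypass_isPath
  set q := w.bypass
  have hq : (q.map (Embedding.induce {u | u ≠ c}).toHom).IsPath :=
    Walk.IsPath.map (Embedding.induce (G := G) _).injective hp
  have hcs : c ∉ (q.map (Embedding.induce {u | u ≠ c}).toHom).support.toFinset := by
    rw [List.mem_toFinset, Walk.support_map, List.mem_map]
    rintro ⟨x, -, hx⟩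
    exact x.2 hx
  exact ⟨_, PS.of_walk _ hq, hcs⟩

lemma noLong_of_circ {V : Type} [DecidableEq V] [Fintype V] {G : SimpleGraph V} {c : ℕ}
    (h2 : 2 ≤ c) (h : circ G = c) : NoLong G c := by
  intro u v S hS huv
  obtain ⟨p, hp, hpS⟩ := hS.to_walk
  have hSc : S.card = p.length + 1 := by
    rw [← hpS, List.toFinset_card_of_nodup hp.support_nodup, Walk.length_support]
  by_contra hlt
  have hcyc : (Walk.cons huv.symm p).IsCycle := by
    rw [Walk.cons_isCycle_iff]
    refine ⟨hp, ?_⟩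
    intro he
    have : p.length = 1 := by
      exact hp.length_eq_one_of_mem_edges (by rwa [Sym2.eq_swap])
    omega
  have : S.card ≤ circ G := by
    unfold circ
    apply le_csSup
    · refine ⟨Fintype.card V, ?_⟩
      rintro n ⟨v, w, hw, rfl⟩
      have := hw.support_nodup.length_le_card
      simpa using this
    · exact ⟨_, _, hcyc, by simp [hSc]⟩
  omega

lemma edgeCount_mono {V : Type} [Fintype V] {G G' : SimpleGraph V} (h : G ≤ G') :
    edgeCount G ≤ edgeCount G' := by
  unfold edgeCount
  exact Nat.card_mono (Set.toFinite _) (edgeSet_mono h)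

lemma two_edgeCount {V : Type} [DecidableEq V] [Fintype V] (G : SimpleGraph V)
    [DecidableRel G.Adj] : 2 * edgeCount G = dd G Finset.univ := by
  unfold edgeCount dd
  rw [Nat.card_eq_fintype_card, ← edgeFinset_card, ← sum_degrees_eq_twice_card_edges]
  apply Finset.sum_congr rfl
  intro x _
  rw [← card_neighborFinset_eq_degree, neighborFinset_eq_filter]

theorem stmt16 (n c : ℕ) (h1 : c ≤ n - 1) (h2 : 4 ≤ c)
    (V : Type) (G : SimpleGraph V) (hV : Nat.card V = n) (hconn : TwoConnected G)
    (hcirc : circ G = c) :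
    edgeCount G ≤ max (fCliques n c 2 2) (fCliques n c (c / 2) 2) := by
  classical
  have hn : c + 1 ≤ n := by omega
  have : Finite V := Nat.finite_of_card_ne_zero (by omega)
  have := Fintype.ofFinite V
  have hc := noLong_of_circ (by omega) hcirc
  obtain ⟨G', hle, hc', hmax⟩ := exists_max c (by omega) hc
  have htc : TC G' := by
    intro z a b ha hb
    obtain ⟨S, hS, hz⟩ := hconn.tc z a b ha hb
    exact ⟨S, hS.mono hle, hz⟩
  have h3 := kopylov_max htc hc' h2 hn (by rw [← hV, Nat.card_eq_fintype_card]) hmax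
  have h4 := edgeCount_mono hle
  have h5 := two_edgeCount G'
  omega
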